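/- Commutation of rewrite steps and equivalence by left-value-free rules: Let ρ be a left-value-free (left-linear) constrained rewrite rule and let ⟨X, s, ∃x⃗.φ⟩ and ⟨Y, t, ∃y⃗.ψ⟩ be satisfiable existentially constrained terms. If ⟨X', s', ∃x⃗'.φ'⟩ ←_ρ ⟨X, s, ∃x⃗.φ⟩ ∼ ⟨Y, t, ∃y⃗.ψ⟩ (a most general rewrite step from ⟨X, s, ∃x⃗.φ⟩ and an equivalence to ⟨Y, t, ∃y⃗.ψ⟩), then there exists an existentially constrained term ⟨Y', t', ∃y⃗'.ψ'⟩ such that ⟨X', s', ∃x⃗'.φ'⟩ ∼ ⟨Y', t', ∃y⃗'.ψ'⟩ ←_ρ ⟨Y, t, ∃y⃗.ψ⟩. -/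

import Mathlib

namespace LCTRS

open scoped Classical

noncomputable section

/-- First-order terms over function symbols `F` and variables `V`. -/
inductive Term (F V : Type) : Type where
  | var : V → Term F V
  | app : F → List (Term F V) → Term F V

variable {F V D : Type}

/-- Occurrence of a variable in a term. -/
inductive Term.VarIn (x : V) : Term F V → Prop where
  | var : Term.VarIn x (Term.var x)
  | app {f : F} {ts : List (Term F V)} {t : Term F V} :
      t ∈ ts → Term.VarIn x t → Term.VarIn x (Term.app f ts)

/-- The set of variables occurring in a term. -/
def Term.vars (t : Term F V) : Set V := {x | Term.VarIn x t}

/-- Application of a substitution to a term. -/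
def Term.subst (t : Term F V) (σ : V → Term F V) : Term F V :=
  match t with
  | .var x => σ x
  | .app f ts => .app f (ts.attach.map (fun u => u.1.subst σ))
decreasing_by
  have := List.sizeOf_lt_of_mem u.2
  simp only [Term.app.sizeOf_spec] at *
  omega

/-- The domain of a substitution. -/
def substDom (σ : V → Term F V) : Set V := {x | σ x ≠ Term.var x}

/-- Positions in a term. -/
abbrev Pos := List Nat

/-- `SubtermAt s p u`: the subterm of `s` at position `p` exists and equals `u`. -/
inductive SubtermAt : Term F V → Pos → Term F V → Prop where
  | refl (t : Term F V) : SubtermAt t [] t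
  | app {f : F} {ts : List (Term F V)} {i : Nat} {t u : Term F V} {p : Pos} :
      ts[i]? = some t → SubtermAt t p u → SubtermAt (Term.app f ts) (i :: p) u

/-- `ReplaceAt s p u t`: replacing the subterm of `s` at position `p` by `u` yields `t`. -/
inductive ReplaceAt : Term F V → Pos → Term F V → Term F V → Prop where
  | here (t u : Term F V) : ReplaceAt t [] u u
  | app {f : F} {ts : List (Term F V)} {i : Nat} {p : Pos} {u t t' : Term F V} :
      ts[i]? = some t → ReplaceAt t p u t' →
      ReplaceAt (Term.app f ts) (i :: p) u (Term.app f (ts.set i t'))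

/-- Replacement at a list of pairwise parallel positions (performed sequentially). -/
inductive ReplaceList : Term F V → List Pos → List (Term F V) → Term F V → Prop where
  | nil (t : Term F V) : ReplaceList t [] [] t
  | cons {t t₁ t₂ : Term F V} {p : Pos} {ps : List Pos} {u : Term F V} {us : List (Term F V)} :
      ReplaceAt t p u t₁ → ReplaceList t₁ ps us t₂ → ReplaceList t (p :: ps) (u :: us) t₂

/-- A term is linear if each variable occurs at most once in it. -/
def Term.Linear (t : Term F V) : Prop :=
  ∀ (x : V) (p q : Pos), SubtermAt t p (Term.var x) → SubtermAt t q (Term.var x) → p = q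

/-- A term is `X`-linear if each variable of `X` occurs at most once in it. -/
def Term.LinearOn (t : Term F V) (X : Set V) : Prop :=
  ∀ x ∈ X, ∀ (p q : Pos), SubtermAt t p (Term.var x) → SubtermAt t q (Term.var x) → p = q

/-- A model over the (theory part of the) signature: an interpretation of the function
symbols over a domain `D`, a designated truth value, a set `Val` of value constants such
that every domain element is denoted by some value, and designated conjunction, equality
and truth symbols interpreted as expected. -/
structure Model (F V D : Type) where
  interp : F → List D → D
  tval : D
  Val : Set F
  andSym : F
  eqSym : F
  trueSym : F
  val_const : ∀ v ∈ Val, ∀ ds : List D, interp v ds = interp v []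
  val_surj : ∀ d : D, ∃ v ∈ Val, interp v [] = d
  and_spec : ∀ a b : D, (interp andSym [a, b] = tval ↔ (a = tval ∧ b = tval))
  eq_spec : ∀ a b : D, (interp eqSym [a, b] = tval ↔ a = b)
  true_spec : interp trueSym [] = tval

/-- Evaluation of a term in a model under a valuation. -/
def Model.eval (M : Model F V D) (ξ : V → D) (t : Term F V) : D :=
  match t with
  | .var x => ξ x
  | .app f ts => M.interp f (ts.attach.map (fun u => M.eval ξ u.1))
decreasing_by
  have := List.sizeOf_lt_of_mem u.2
  simp only [Term.app.sizeOf_spec] at *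
  omega

/-- A constraint holds in `M` under the valuation `ξ`. -/
def Model.holds (M : Model F V D) (ξ : V → D) (φ : Term F V) : Prop := M.eval ξ φ = M.tval

/-- `⊨_M φ`: the constraint `φ` holds under every valuation. -/
def Model.validC (M : Model F V D) (φ : Term F V) : Prop := ∀ ξ : V → D, M.holds ξ φ

/-- `t` is a value (a constant from `Val`). -/
def Model.IsValueTerm (M : Model F V D) (t : Term F V) : Prop := ∃ v ∈ M.Val, t = Term.app v []

/-- The root symbol of `t` is a value symbol. -/
def Model.IsValueSym (M : Model F V D) (t : Term F V) : Prop :=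
  ∃ v ∈ M.Val, ∃ ts : List (Term F V), t = Term.app v ts

/-- No value occurs in `t`. -/
def Term.ValueFree (t : Term F V) (M : Model F V D) : Prop :=
  ∀ (p : Pos) (u : Term F V), SubtermAt t p u → ¬ M.IsValueSym u

/-- The conjunction `φ ∧ ψ` as a constraint. -/
def Model.conj (M : Model F V D) (φ ψ : Term F V) : Term F V := Term.app M.andSym [φ, ψ]

/-- The equation `s = t` as a constraint. -/
def Model.eqc (M : Model F V D) (s t : Term F V) : Term F V := Term.app M.eqSym [s, t]

/-- The constraint `true`. -/
def Model.trueC (M : Model F V D) : Term F V := Term.app M.trueSym []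

/-- `φ ∧ ψ₁ ∧ ⋯ ∧ ψₙ`. -/
def Model.conjFrom (M : Model F V D) (φ : Term F V) (l : List (Term F V)) : Term F V :=
  l.foldl M.conj φ

/-- `ψ₁ ∧ ⋯ ∧ ψₙ`. -/
def Model.bigConj (M : Model F V D) (l : List (Term F V)) : Term F V :=
  l.foldl M.conj M.trueC

/-- An existential constraint `⟨∃x⃗. φ⟩`: a set of (bound) variables together with a
constraint. -/
structure EC (F V : Type) where
  bvars : Set V
  constr : Term F V

/-- Well-formedness of an existential constraint: `{x⃗} ⊆ Var(φ)`. -/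
def EC.WF (c : EC F V) : Prop := c.bvars ⊆ c.constr.vars

/-- Free variables of an existential constraint. -/
def EC.fvars (c : EC F V) : Set V := c.constr.vars \ c.bvars

/-- `⟨∃x⃗. φ⟩` holds under valuation `ξ`: `φκ` holds under `ξ` for some substitution `κ`
mapping `x⃗` into `Val` (and the identity elsewhere). -/
def EC.holdsUnder (c : EC F V) (M : Model F V D) (ξ : V → D) : Prop :=
  ∃ κ : V → Term F V, (∀ x ∈ c.bvars, M.IsValueTerm (κ x)) ∧
    (∀ x ∉ c.bvars, κ x = Term.var x) ∧ M.holds ξ (c.constr.subst κ)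

/-- `⊨_M ⟨∃x⃗. φ⟩`. -/
def EC.validM (c : EC F V) (M : Model F V D) : Prop := ∀ ξ : V → D, c.holdsUnder M ξ

/-- Satisfiability of an existential constraint. -/
def EC.satisfiable (c : EC F V) (M : Model F V D) : Prop := ∃ ξ : V → D, c.holdsUnder M ξ

/-- Application of a substitution to an existential constraint acts on the free
variables only. -/
def EC.subst (c : EC F V) (σ : V → Term F V) : EC F V :=
  ⟨c.bvars, c.constr.subst (fun x => if x ∈ c.bvars then Term.var x else σ x)⟩

/-- `⊨_M ⟨∃x⃗.φ⟩ ⇔ ⟨∃y⃗.ψ⟩`. -/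
def ECIffM (M : Model F V D) (c c' : EC F V) : Prop :=
  ∀ ξ : V → D, c.holdsUnder M ξ ↔ c'.holdsUnder M ξ

/-- `σ ⊨_M ⟨∃x⃗.φ⟩`: `σ` maps the free variables into values and `(⟨∃x⃗.φ⟩)σ` is valid. -/
def SubstRespectsEC (M : Model F V D) (σ : V → Term F V) (c : EC F V) : Prop :=
  (∀ x ∈ c.fvars, M.IsValueTerm (σ x)) ∧ (c.subst σ).validM M

/-- `σ` respects the plain constraint `φ`. -/
def SubstRespects (M : Model F V D) (σ : V → Term F V) (φ : Term F V) : Prop :=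
  (∀ x ∈ φ.vars, M.IsValueTerm (σ x)) ∧ M.validC (φ.subst σ)

/-- An existentially constrained term `⟨X, s, ∃x⃗.φ⟩`. -/
structure ECTerm (F V : Type) where
  lvars : Set V
  term : Term F V
  ec : EC F V

/-- Well-formedness: `{x⃗} ⊆ Var(φ)`, `FVar(⟨∃x⃗.φ⟩) ⊆ X ⊆ Var(s)` and `{x⃗} ∩ Var(s) = ∅`. -/
def ECTerm.WF (T : ECTerm F V) : Prop :=
  T.ec.WF ∧ T.ec.fvars ⊆ T.lvars ∧ T.lvars ⊆ T.term.vars ∧ ∀ x ∈ T.ec.bvars, x ∉ T.term.vars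

/-- Satisfiability of an existentially constrained term. -/
def ECTerm.satisfiable (T : ECTerm F V) (M : Model F V D) : Prop := T.ec.satisfiable M

/-- `T` is subsumed by `T'`. -/
def SubsumedBy (M : Model F V D) (T T' : ECTerm F V) : Prop :=
  ∀ σ : V → Term F V, (∀ x ∈ T.lvars, M.IsValueTerm (σ x)) → SubstRespectsEC M σ T.ec →
    ∃ γ : V → Term F V, (∀ y ∈ T'.lvars, M.IsValueTerm (γ y)) ∧ SubstRespectsEC M γ T'.ec ∧
      T.term.subst σ = T'.term.subst γ

/-- Equivalence of existentially constrained terms. -/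
def ECEquiv (M : Model F V D) (T T' : ECTerm F V) : Prop :=
  SubsumedBy M T T' ∧ SubsumedBy M T' T

/-- An existentially constrained term is pattern-general if its term is linear in its
logical variables and contains no value. -/
def ECTerm.PatternGeneral (T : ECTerm F V) (M : Model F V D) : Prop :=
  T.term.LinearOn T.lvars ∧ T.term.ValueFree M

/-- A constrained rewrite rule `Π Z. ℓ → r [π]`. -/
structure Rule (F V : Type) where
  Z : Set V
  lhs : Term F V
  rhs : Term F V
  constr : Term F V

/-- `Var(ρ)`. -/
def Rule.vars (ρ : Rule F V) : Set V := ρ.lhs.vars ∪ ρ.rhs.vars ∪ ρ.constr.vars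

/-- `ExVar(ρ) = Var(r) \ Var(ℓ)`. -/
def Rule.exVars (ρ : Rule F V) : Set V := ρ.rhs.vars \ ρ.lhs.vars

/-- Well-formedness of a rule: `(Var(r) \ Var(ℓ)) ∪ Var(π) ⊆ Z ⊆ Var(ℓ,r,π)`. -/
def Rule.WF (ρ : Rule F V) : Prop :=
  (ρ.rhs.vars \ ρ.lhs.vars) ∪ ρ.constr.vars ⊆ ρ.Z ∧ ρ.Z ⊆ ρ.vars

/-- Left-linearity. -/
def Rule.LeftLinear (ρ : Rule F V) : Prop := ρ.lhs.Linear

/-- A rule is left-value-free if it is left-linear and no value occurs in its lhs. -/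
def Rule.LeftValueFree (ρ : Rule F V) (M : Model F V D) : Prop :=
  ρ.LeftLinear ∧ ρ.lhs.ValueFree M

/-- `ρ'` is a renamed variant of `ρ`. -/
def Rule.IsVariantOf (ρ' ρ : Rule F V) : Prop :=
  ∃ δ : V → V, Function.Bijective δ ∧
    ρ'.Z = δ '' ρ.Z ∧ ρ'.lhs = ρ.lhs.subst (fun x => Term.var (δ x)) ∧
    ρ'.rhs = ρ.rhs.subst (fun x => Term.var (δ x)) ∧
    ρ'.constr = ρ.constr.subst (fun x => Term.var (δ x))

/-- `⟨X,s,∃x⃗.φ⟩` has a `ρ`-redex at position `p` using substitution `γ`. -/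
structure RedexAt (M : Model F V D) (ρ : Rule F V) (T : ECTerm F V)
    (p : Pos) (γ : V → Term F V) : Prop where
  dom : substDom γ = ρ.lhs.vars
  matchAt : SubtermAt T.term p (ρ.lhs.subst γ)
  lvar : ∀ x ∈ ρ.lhs.vars ∩ ρ.Z, M.IsValueTerm (γ x) ∨ ∃ y ∈ T.lvars, γ x = Term.var y
  implied : ∀ ξ : V → D, T.ec.holdsUnder M ξ →
    EC.holdsUnder ⟨ρ.constr.vars \ ρ.lhs.vars, ρ.constr.subst γ⟩ M ξ

/-- A most general rewrite step at position `p` using substitution `γ`. -/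
structure MGStepData (M : Model F V D) (ρ : Rule F V) (T T' : ECTerm F V)
    (p : Pos) (γ : V → Term F V) : Prop where
  redex : RedexAt M ρ T p γ
  target : ReplaceAt T.term p (ρ.rhs.subst γ) T'.term
  cstr : T'.ec.constr = M.conj T.ec.constr (ρ.constr.subst γ)
  bnd : T'.ec.bvars = T'.ec.constr.vars \ T'.term.vars
  lv : T'.lvars = ρ.exVars ∪ (T.lvars ∩ T'.term.vars)

/-- A most general rewrite step at position `p`. -/
def MGStepAt (M : Model F V D) (ρ : Rule F V) (p : Pos) (T T' : ECTerm F V) : Prop :=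
  ∃ γ : V → Term F V, MGStepData M ρ T T' p γ

/-- A most general rewrite step. -/
def MGStep (M : Model F V D) (ρ : Rule F V) (T T' : ECTerm F V) : Prop :=
  ∃ (p : Pos) (γ : V → Term F V), MGStepData M ρ T T' p γ

/-- A non-quantified constrained term `⟨X, s, φ⟩`. -/
structure NQTerm (F V : Type) where
  lvars : Set V
  term : Term F V
  constr : Term F V

/-- Well-formedness: `Var(φ) ⊆ X ⊆ Var(φ, s)`. -/
def NQTerm.WF (T : NQTerm F V) : Prop :=
  T.constr.vars ⊆ T.lvars ∧ T.lvars ⊆ T.constr.vars ∪ T.term.vars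

/-- Satisfiability of a non-quantified constrained term. -/
def NQTerm.satisfiable (T : NQTerm F V) (M : Model F V D) : Prop :=
  ∃ ξ : V → D, M.holds ξ T.constr

/-- Subsumption of non-quantified constrained terms. -/
def NQSubsumedBy (M : Model F V D) (T T' : NQTerm F V) : Prop :=
  ∀ σ : V → Term F V, (∀ x ∈ T.lvars, M.IsValueTerm (σ x)) → SubstRespects M σ T.constr →
    ∃ γ : V → Term F V, (∀ y ∈ T'.lvars, M.IsValueTerm (γ y)) ∧ SubstRespects M γ T'.constr ∧
      T.term.subst σ = T'.term.subst γ

/-- Equivalence of non-quantified constrained terms. -/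
def NQEquiv (M : Model F V D) (T T' : NQTerm F V) : Prop :=
  NQSubsumedBy M T T' ∧ NQSubsumedBy M T' T

/-- A rewrite step on non-quantified constrained terms at position `p` using `σ`. -/
structure NQStepData (M : Model F V D) (ρ : Rule F V) (T T' : NQTerm F V)
    (p : Pos) (σ : V → Term F V) : Prop where
  fresh : Disjoint ρ.vars (T.lvars ∪ T.term.vars ∪ T.constr.vars)
  funpos : ∃ (f : F) (ts : List (Term F V)), SubtermAt T.term p (Term.app f ts)
  dom : substDom σ = ρ.vars
  matchAt : SubtermAt T.term p (ρ.lhs.subst σ)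
  zval : ∀ x ∈ ρ.Z, M.IsValueTerm (σ x) ∨ ∃ y ∈ T.lvars, σ x = Term.var y
  implied : ∀ ξ : V → D, M.holds ξ T.constr → M.holds ξ (ρ.constr.subst σ)
  target : ReplaceAt T.term p (ρ.rhs.subst σ) T'.term
  cstr : T'.constr = T.constr
  lv : T'.lvars = T.lvars ∩ (T'.term.vars ∪ T.constr.vars)

/-- A rewrite step on non-quantified constrained terms. -/
def NQStep (M : Model F V D) (ρ : Rule F V) (T T' : NQTerm F V) : Prop :=
  ∃ (p : Pos) (σ : V → Term F V), NQStepData M ρ T T' p σ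

/-- The existential removing translation `rmv`. -/
def rmv (T : ECTerm F V) : NQTerm F V := ⟨T.lvars ∪ T.ec.bvars, T.term, T.ec.constr⟩

/-- The existential extension translation `ext`. -/
def ext (T : NQTerm F V) : ECTerm F V :=
  ⟨T.lvars \ (T.constr.vars \ T.term.vars), T.term, ⟨T.constr.vars \ T.term.vars, T.constr⟩⟩

/-- Positions of `s` whose symbol is a variable of `X` or a value. -/
def PosXVal (M : Model F V D) (X : Set V) (s : Term F V) : Set Pos :=
  {p | ∃ u : Term F V, SubtermAt s p u ∧ ((∃ x ∈ X, u = Term.var x) ∨ M.IsValueSym u)}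

/-- `s'` is the bullet translation `s^{•X}` of `s`, obtained by replacing the subterms at
the positions `ps` (which enumerate `Pos_{X∪Val}(s)`) by the pairwise distinct fresh
variables `xs`. -/
structure BulletData (M : Model F V D) (X avoid : Set V) (s : Term F V)
    (ps : List Pos) (xs : List V) (s' : Term F V) : Prop where
  nodup_ps : ps.Nodup
  cover : ∀ p : Pos, p ∈ ps ↔ p ∈ PosXVal M X s
  nodup_xs : xs.Nodup
  len : xs.length = ps.length
  fresh : ∀ x ∈ xs, x ∉ avoid
  repl : ReplaceList s ps (xs.map Term.var) s'

/-- `T'` is the pattern-general translation `PG(T)` of `T` (with fresh variables chosen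
outside `avoid`). -/
def IsPG (M : Model F V D) (avoid : Set V) (T T' : ECTerm F V) : Prop :=
  ∃ (ps : List Pos) (xs : List V) (us : List (Term F V)),
    BulletData M T.lvars avoid T.term ps xs T'.term ∧
    List.Forall₂ (fun p u => SubtermAt T.term p u) ps us ∧
    T'.lvars = {x | x ∈ xs} ∧
    T'.ec.bvars = T.ec.bvars ∪ T.lvars ∧
    T'.ec.constr = M.conjFrom T.ec.constr (List.zipWith M.eqc us (xs.map Term.var))

/-- `ρh` is the left-value-free transformation `lvf(ρ)` of `ρ`. -/
def IsLVF (M : Model F V D) (ρ ρh : Rule F V) : Prop :=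
  ∃ (ps : List Pos) (xs : List V) (vs : List (Term F V)),
    ps.Nodup ∧ xs.Nodup ∧ xs.length = ps.length ∧
    (∀ p : Pos, p ∈ ps ↔ p ∈ PosXVal M (∅ : Set V) ρ.lhs) ∧
    List.Forall₂ (fun p v => SubtermAt ρ.lhs p v ∧ M.IsValueTerm v) ps vs ∧
    (∀ x ∈ xs, x ∉ ρ.vars) ∧
    ρh.Z = ρ.Z ∪ {x | x ∈ xs} ∧
    ReplaceList ρ.lhs ps (xs.map Term.var) ρh.lhs ∧
    ρh.rhs = ρ.rhs ∧
    ρh.constr = M.conjFrom ρ.constr (List.zipWith M.eqc (xs.map Term.var) vs)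

/-- A most general rewrite step with a fresh variant of some rule of the LCTRS `R`. -/
def StepR (M : Model F V D) (R : Set (Rule F V)) (T T' : ECTerm F V) : Prop :=
  ∃ ρ ∈ R, ∃ ρ' : Rule F V, ρ'.IsVariantOf ρ ∧
    Disjoint ρ'.vars (T.term.vars ∪ T.ec.constr.vars) ∧ MGStep M ρ' T T'

/-- One `∼ · →_R` step (on well-formed, satisfiable existentially constrained terms). -/
def SimStep (M : Model F V D) (R : Set (Rule F V)) (T T' : ECTerm F V) : Prop :=
  ∃ U : ECTerm F V, U.WF ∧ U.satisfiable M ∧ ECEquiv M T U ∧ StepR M R U T'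

/-- `n`-fold composition of a relation. -/
def RelPow {α : Type _} (r : α → α → Prop) : ℕ → α → α → Prop
  | 0 => fun a b => a = b
  | n + 1 => fun a c => ∃ b, r a b ∧ RelPow r n b c


theorem Term.induction {P : Term F V → Prop} (hv : ∀ x, P (.var x))
    (ha : ∀ f ts, (∀ t ∈ ts, P t) → P (.app f ts)) : ∀ t, P t
  | .var x => hv x
  | .app f ts => ha f ts (fun t _ => Term.induction hv ha t)

@[simp] theorem Term.subst_var (x : V) (σ : V → Term F V) : (Term.var x).subst σ = σ x := by
  rw [Term.subst]

@[simp] theorem Term.subst_app (f : F) (ts : List (Term F V)) (σ : V → Term F V) :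
    (Term.app f ts).subst σ = .app f (ts.map (fun u => u.subst σ)) := by
  rw [Term.subst, List.attach_map_val (f := fun u : Term F V => u.subst σ)]

@[simp] theorem Model.eval_var (M : Model F V D) (ξ : V → D) (x : V) :
    M.eval ξ (.var x) = ξ x := by
  rw [Model.eval]

@[simp] theorem Model.eval_app (M : Model F V D) (ξ : V → D) (f : F) (ts : List (Term F V)) :
    M.eval ξ (.app f ts) = M.interp f (ts.map (M.eval ξ)) := by
  rw [Model.eval, List.attach_map_val (f := M.eval ξ)]

@[simp] theorem Term.mem_vars_var {x y : V} : y ∈ (Term.var x : Term F V).vars ↔ y = x := by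
  constructor
  · intro h
    cases (h : Term.VarIn y (Term.var x)) with
    | var => rfl
  · rintro rfl
    exact .var

@[simp] theorem Term.mem_vars_app {f : F} {ts : List (Term F V)} {y : V} :
    y ∈ (Term.app f ts).vars ↔ ∃ t ∈ ts, y ∈ t.vars := by
  constructor
  · intro h
    cases (h : Term.VarIn y (Term.app f ts)) with
    | app h₁ h₂ => exact ⟨_, h₁, h₂⟩
  · rintro ⟨t, h₁, h₂⟩
    exact .app h₁ h₂

theorem Term.subst_subst (t : Term F V) (σ τ : V → Term F V) :
    (t.subst σ).subst τ = t.subst (fun x => (σ x).subst τ) := by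
  induction t using Term.induction with
  | hv x => simp
  | ha f ts ih => simpa using ih

theorem Term.subst_eq_subst_iff {t : Term F V} {σ τ : V → Term F V} :
    t.subst σ = t.subst τ ↔ ∀ x ∈ t.vars, σ x = τ x := by
  induction t using Term.induction with
  | hv x => simp
  | ha f ts ih =>
    simp only [Term.subst_app, Term.app.injEq, true_and, List.map_inj_left, Term.mem_vars_app]
    constructor
    · rintro h x ⟨t, ht, hx⟩
      exact (ih t ht).1 (h t ht) x hx
    · intro h t ht
      exact (ih t ht).2 (fun x hx => h x ⟨t, ht, hx⟩)

theorem Term.mem_vars_subst {t : Term F V} {σ : V → Term F V} {y : V} :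
    y ∈ (t.subst σ).vars ↔ ∃ x ∈ t.vars, y ∈ (σ x).vars := by
  induction t using Term.induction with
  | hv x => simp
  | ha f ts ih =>
    simp only [Term.subst_app, Term.mem_vars_app, List.mem_map]
    constructor
    · rintro ⟨_, ⟨t, ht, rfl⟩, hy⟩
      obtain ⟨x, hx, hy⟩ := (ih t ht).1 hy
      exact ⟨x, ⟨t, ht, hx⟩, hy⟩
    · rintro ⟨x, ⟨t, ht, hx⟩, hy⟩
      exact ⟨_, ⟨t, ht, rfl⟩, (ih t ht).2 ⟨x, hx, hy⟩⟩

theorem Model.eval_subst (M : Model F V D) (ξ : V → D) (t : Term F V) (σ : V → Term F V) :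
    M.eval ξ (t.subst σ) = M.eval (fun x => M.eval ξ (σ x)) t := by
  induction t using Term.induction with
  | hv x => simp
  | ha f ts ih =>
    simp only [Term.subst_app, Model.eval_app, List.map_map]
    congr 1
    exact List.map_congr_left ih

theorem Model.eval_congr (M : Model F V D) {ξ η : V → D} {t : Term F V}
    (h : ∀ x ∈ t.vars, ξ x = η x) : M.eval ξ t = M.eval η t := by
  induction t using Term.induction with
  | hv x => simpa using h
  | ha f ts ih =>
    simp only [Model.eval_app]
    congr 1
    exact List.map_congr_left
      (fun t ht => ih t ht (fun x hx => h x (Term.mem_vars_app.2 ⟨t, ht, hx⟩)))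

theorem Model.holds_congr (M : Model F V D) {ξ η : V → D} {t : Term F V}
    (h : ∀ x ∈ t.vars, ξ x = η x) : M.holds ξ t ↔ M.holds η t := by
  rw [Model.holds, Model.holds, M.eval_congr h]

theorem Model.holds_subst (M : Model F V D) (ξ : V → D) (t : Term F V) (σ : V → Term F V) :
    M.holds ξ (t.subst σ) ↔ M.holds (fun x => M.eval ξ (σ x)) t := by
  rw [Model.holds, Model.holds, M.eval_subst]

theorem Model.holds_conj (M : Model F V D) (ξ : V → D) (φ ψ : Term F V) :
    M.holds ξ (M.conj φ ψ) ↔ M.holds ξ φ ∧ M.holds ξ ψ := by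
  simp only [Model.holds, Model.conj, Model.eval_app, List.map_cons, List.map_nil]
  exact M.and_spec _ _

theorem Model.mem_vars_conj (M : Model F V D) {φ ψ : Term F V} {x : V} :
    x ∈ (M.conj φ ψ).vars ↔ x ∈ φ.vars ∨ x ∈ ψ.vars := by
  simp [Model.conj]

/-- The element denoted by a ground theory term. -/
def Model.den (M : Model F V D) (t : Term F V) : D := M.eval (fun _ => M.tval) t

/-- A value denoting a given element. -/
def Model.valTerm (M : Model F V D) (d : D) : Term F V := .app (M.val_surj d).choose []

theorem Model.isValueTerm_valTerm (M : Model F V D) (d : D) : M.IsValueTerm (M.valTerm d) :=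
  ⟨_, (M.val_surj d).choose_spec.1, rfl⟩

@[simp] theorem Model.eval_valTerm (M : Model F V D) (ξ : V → D) (d : D) :
    M.eval ξ (M.valTerm d) = d := by
  simpa [Model.valTerm] using (M.val_surj d).choose_spec.2

@[simp] theorem Model.den_valTerm (M : Model F V D) (d : D) :
    M.den (M.valTerm d : Term F V) = d := M.eval_valTerm _ d

theorem Model.IsValueTerm.notMem_vars {M : Model F V D} {t : Term F V} (h : M.IsValueTerm t)
    (x : V) : x ∉ t.vars := by
  obtain ⟨v, -, rfl⟩ := h
  simp

theorem Model.IsValueTerm.eval_eq_den {M : Model F V D} {t : Term F V} (h : M.IsValueTerm t)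
    (ξ : V → D) : M.eval ξ t = M.den t :=
  M.eval_congr (fun x hx => (h.notMem_vars x hx).elim)

theorem Model.eval_eq_den_subst (M : Model F V D) {η : V → D} {t : Term F V} {σ : V → Term F V}
    (h : ∀ x ∈ t.vars, η x = M.den (σ x)) : M.eval η t = M.den (t.subst σ) := by
  rw [Model.den, M.eval_subst]
  exact M.eval_congr h

theorem EC.holdsUnder_iff {c : EC F V} {M : Model F V D} {ξ : V → D} :
    c.holdsUnder M ξ ↔ ∃ η : V → D, (∀ x ∈ c.fvars, η x = ξ x) ∧ M.holds η c.constr := by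
  constructor
  · rintro ⟨κ, -, hκ, h⟩
    refine ⟨fun x => M.eval ξ (κ x), fun x hx => ?_, (M.holds_subst _ _ _).1 h⟩
    simp [hκ x hx.2]
  · rintro ⟨η, hη, h⟩
    refine ⟨fun x => if x ∈ c.bvars then M.valTerm (η x) else .var x, fun x hx => ?_,
      fun x hx => ?_, ?_⟩
    · simpa [hx] using M.isValueTerm_valTerm _
    · simp [hx]
    · rw [M.holds_subst]
      refine (M.holds_congr fun x hx => ?_).2 h
      by_cases hb : x ∈ c.bvars
      · simp [hb]
      · simpa [hb] using (hη x ⟨hx, hb⟩).symm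

theorem substRespectsEC_iff {M : Model F V D} {σ : V → Term F V} {c : EC F V} :
    SubstRespectsEC M σ c ↔ (∀ x ∈ c.fvars, M.IsValueTerm (σ x)) ∧
      ∃ η : V → D, (∀ x ∈ c.fvars, η x = M.den (σ x)) ∧ M.holds η c.constr := by
  refine and_congr_right fun hv => ?_
  have hsub : ∀ η : V → D, M.holds η (c.subst σ).constr ↔
      M.holds (fun x => if x ∈ c.bvars then η x else M.eval η (σ x)) c.constr := fun η => by
    rw [EC.subst, M.holds_subst]
    refine M.holds_congr fun x _ => ?_
    by_cases hb : x ∈ c.bvars <;> simp [hb]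
  constructor
  · intro h
    obtain ⟨η, -, h⟩ := EC.holdsUnder_iff.1 (h (fun _ => M.tval))
    refine ⟨_, fun x hx => ?_, (hsub η).1 h⟩
    simpa [hx.2] using (hv x hx).eval_eq_den η
  · rintro ⟨η, hη, h⟩ ξ
    refine EC.holdsUnder_iff.2 ⟨fun x => if x ∈ c.bvars then η x else ξ x, fun x hx => ?_, ?_⟩
    · exact if_neg hx.2
    · refine (hsub _).2 ((M.holds_congr fun x hx => ?_).1 h)
      by_cases hb : x ∈ c.bvars
      · simp [hb]
      · simpa only [hb, if_false, (hv x ⟨hx, hb⟩).eval_eq_den] using hη x ⟨hx, hb⟩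

theorem SubtermAt.unique {s u v : Term F V} {p : Pos} (hu : SubtermAt s p u)
    (hv : SubtermAt s p v) : u = v := by
  induction hu with
  | refl t => cases hv; rfl
  | app h₁ _ ih =>
    cases hv with
    | app h₃ h₄ =>
      rw [h₁] at h₃
      cases h₃
      exact ih h₄

theorem SubtermAt.subst {s u : Term F V} {p : Pos} (h : SubtermAt s p u) (σ : V → Term F V) :
    SubtermAt (s.subst σ) p (u.subst σ) := by
  induction h with
  | refl t => exact .refl _
  | app h₁ _ ih =>
    rw [Term.subst_app]
    exact .app (by rw [List.getElem?_map, h₁]; rfl) ih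

theorem SubtermAt.vars_subset {s u : Term F V} {p : Pos} (h : SubtermAt s p u) :
    u.vars ⊆ s.vars := by
  induction h with
  | refl t => exact subset_rfl
  | app h₁ _ ih => exact fun x hx => Term.mem_vars_app.2 ⟨_, List.mem_of_getElem? h₁, ih hx⟩

theorem Term.exists_subtermAt_var {t : Term F V} {x : V} (h : x ∈ t.vars) :
    ∃ p, SubtermAt t p (.var x) := by
  induction t using Term.induction with
  | hv y =>
    rw [Term.mem_vars_var] at h
    exact ⟨[], h ▸ .refl _⟩
  | ha f ts ih =>
    obtain ⟨t, ht, hx⟩ := Term.mem_vars_app.1 h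
    obtain ⟨p, hp⟩ := ih t ht hx
    obtain ⟨i, hi⟩ := List.mem_iff_getElem?.1 ht
    exact ⟨i :: p, .app hi hp⟩

theorem ReplaceAt.unique {s u t t' : Term F V} {p : Pos} (h : ReplaceAt s p u t)
    (h' : ReplaceAt s p u t') : t = t' := by
  induction h generalizing t' with
  | here t u => cases h'; rfl
  | app h₁ _ ih =>
    cases h' with
    | app h₃ h₄ =>
      rw [h₁] at h₃
      cases h₃
      rw [ih h₄]

theorem ReplaceAt.subst {s u t : Term F V} {p : Pos} (h : ReplaceAt s p u t)
    (σ : V → Term F V) : ReplaceAt (s.subst σ) p (u.subst σ) (t.subst σ) := by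
  induction h with
  | here t u => exact .here _ _
  | app h₁ _ ih =>
    rw [Term.subst_app, Term.subst_app, List.map_set]
    exact .app (by rw [List.getElem?_map, h₁]; rfl) ih

theorem ReplaceAt.vars_subset {s u t : Term F V} {p : Pos} (h : ReplaceAt s p u t) :
    t.vars ⊆ s.vars ∪ u.vars := by
  induction h with
  | here t u => exact Set.subset_union_right
  | app h₁ _ ih =>
    intro x hx
    obtain ⟨w, hw, hxw⟩ := Term.mem_vars_app.1 hx
    rcases List.mem_or_eq_of_mem_set hw with hw | rfl
    · exact .inl (Term.mem_vars_app.2 ⟨w, hw, hxw⟩)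
    · exact (ih hxw).imp_left
        (fun hx => Term.mem_vars_app.2 ⟨_, List.mem_of_getElem? h₁, hx⟩)

theorem ReplaceAt.vars_inserted_subset {s u t : Term F V} {p : Pos} (h : ReplaceAt s p u t) :
    u.vars ⊆ t.vars := by
  induction h with
  | here t u => exact subset_rfl
  | app h₁ _ ih =>
    intro x hx
    obtain ⟨hi, -⟩ := List.getElem?_eq_some_iff.1 h₁
    exact Term.mem_vars_app.2 ⟨_, List.mem_set hi _, ih hx⟩

theorem SubtermAt.exists_replaceAt {s u : Term F V} {p : Pos} (h : SubtermAt s p u)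
    (w : Term F V) : ∃ t, ReplaceAt s p w t := by
  induction h with
  | refl t => exact ⟨w, .here _ _⟩
  | app h₁ _ ih =>
    obtain ⟨t, ht⟩ := ih
    exact ⟨_, .app h₁ ht⟩

/-- Some instance of `s` that instantiates exactly the variables in `X`, by values, is an
instance of `t` that maps `Y` to values. -/
def InstanceOf (M : Model F V D) (X Y : Set V) (s t : Term F V) : Prop :=
  ∃ σ τ : V → Term F V, (∀ x ∈ X, M.IsValueTerm (σ x)) ∧ (∀ x ∉ X, σ x = .var x) ∧
    (∀ y ∈ Y, M.IsValueTerm (τ y)) ∧ s.subst σ = t.subst τ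

/-- Two terms are similar if they agree up to logical variables and values. -/
def Similar (M : Model F V D) (X Y : Set V) (s t : Term F V) : Prop :=
  InstanceOf M X Y s t ∧ InstanceOf M Y X t s

theorem SubsumedBy.instanceOf {M : Model F V D} {T S : ECTerm F V} (h : SubsumedBy M T S)
    (hT : T.WF) (hsat : T.satisfiable M) : InstanceOf M T.lvars S.lvars T.term S.term := by
  obtain ⟨ξ, hξ⟩ := hsat
  obtain ⟨η, -, hη⟩ := EC.holdsUnder_iff.1 hξ
  have hX : ∀ x ∈ T.lvars,
      (if x ∈ T.lvars then M.valTerm (η x) else .var x : Term F V) = M.valTerm (η x) :=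
    fun x hx => if_pos hx
  obtain ⟨τ, hτ, -, heq⟩ := h (fun x => if x ∈ T.lvars then M.valTerm (η x) else .var x)
    (fun x hx => by rw [hX x hx]; exact M.isValueTerm_valTerm _)
    (substRespectsEC_iff.2 ⟨fun x hx => by rw [hX x (hT.2.1 hx)]; exact M.isValueTerm_valTerm _,
      η, fun x hx => by rw [hX x (hT.2.1 hx), M.den_valTerm], hη⟩)
  exact ⟨_, τ, fun x hx => by rw [hX x hx]; exact M.isValueTerm_valTerm _,
    fun x hx => if_neg hx, hτ, heq⟩

theorem InstanceOf.subterm {M : Model F V D} {X Y : Set V} {s t u v : Term F V} {p : Pos}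
    (h : InstanceOf M X Y s t) (hu : SubtermAt s p u) (hv : SubtermAt t p v) :
    InstanceOf M X Y u v := by
  obtain ⟨σ, τ, h₁, h₂, h₃, heq⟩ := h
  refine ⟨σ, τ, h₁, h₂, h₃, (hu.subst σ).unique ?_⟩
  rw [heq]
  exact hv.subst τ

theorem Similar.subterm {M : Model F V D} {X Y : Set V} {s t u v : Term F V} {p : Pos}
    (h : Similar M X Y s t) (hu : SubtermAt s p u) (hv : SubtermAt t p v) :
    Similar M X Y u v :=
  ⟨h.1.subterm hu hv, h.2.subterm hv hu⟩

theorem Similar.exists_app {M : Model F V D} {X Y : Set V} {f : F} {ss : List (Term F V)}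
    {t : Term F V} (h : Similar M X Y (.app f ss) t) (hf : f ∉ M.Val ∨ ss ≠ []) :
    ∃ ts, t = .app f ts ∧ ts.length = ss.length := by
  obtain ⟨⟨σ, τ, -, -, hτ, heq⟩, σ', τ', -, hσ', -, heq'⟩ := h
  cases t with
  | var y =>
    by_cases hy : y ∈ Y
    · obtain ⟨v, hv, hvy⟩ := hτ y hy
      simp only [Term.subst_app, Term.subst_var, hvy, Term.app.injEq, List.map_eq_nil_iff] at heq
      obtain ⟨rfl, rfl⟩ := heq
      exact hf.elim (fun h => (h hv).elim) (fun h => (h rfl).elim)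
    · simp [hσ' y hy] at heq'
  | app g ts =>
    simp only [Term.subst_app, Term.app.injEq] at heq
    obtain ⟨rfl, heq⟩ := heq
    exact ⟨ts, rfl, by simpa using congrArg List.length heq.symm⟩

theorem Similar.exists_subtermAt {M : Model F V D} {X Y : Set V} {s t u : Term F V} {p : Pos}
    (h : Similar M X Y s t) (hu : SubtermAt s p u) : ∃ v, SubtermAt t p v := by
  induction hu generalizing t with
  | refl s => exact ⟨t, .refl t⟩
  | @app f ss i s u p h₁ _ ih =>
    obtain ⟨ts, rfl, hlen⟩ := h.exists_app (.inr (by rintro rfl; simp at h₁))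
    obtain ⟨hi, -⟩ := List.getElem?_eq_some_iff.1 h₁
    have h₂ : ts[i]? = some ts[i] := List.getElem?_eq_getElem (hlen ▸ hi)
    obtain ⟨v, hv⟩ := ih (h.subterm (.app h₁ (.refl _)) (.app h₂ (.refl _)))
    exact ⟨v, .app h₂ hv⟩

theorem Similar.value_or_lvar {M : Model F V D} {X Y : Set V} {s t : Term F V}
    (h : Similar M X Y s t) (hs : M.IsValueTerm s ∨ ∃ x ∈ X, s = .var x) :
    M.IsValueTerm t ∨ ∃ y ∈ Y, t = .var y := by
  obtain ⟨-, σ, τ, -, hσ, hτ, heq⟩ := h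
  obtain ⟨v, hv, hst⟩ : M.IsValueTerm (s.subst τ) := by
    rcases hs with ⟨v, hv, rfl⟩ | ⟨x, hx, rfl⟩
    · exact ⟨v, hv, by simp⟩
    · simpa using hτ x hx
  rw [hst] at heq
  cases t with
  | var y =>
    by_cases hy : y ∈ Y
    · exact .inr ⟨y, hy, rfl⟩
    · simp [hσ y hy] at heq
  | app g ts =>
    simp only [Term.subst_app, Term.app.injEq, List.map_eq_nil_iff] at heq
    obtain ⟨rfl, rfl⟩ := heq
    exact .inl ⟨g, hv, rfl⟩

theorem Similar.exists_match {M : Model F V D} {X Y : Set V} {l t : Term F V}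
    {γ : V → Term F V} (hlin : l.Linear) (hvf : l.ValueFree M)
    (h : Similar M X Y (l.subst γ) t) : ∃ δ, t = l.subst δ := by
  induction l using Term.induction generalizing t with
  | hv x => exact ⟨fun _ => t, by simp⟩
  | ha f ls ih =>
    rw [Term.subst_app] at h
    obtain ⟨ts, rfl, hlen⟩ := h.exists_app (.inl fun hf => hvf [] _ (.refl _) ⟨f, hf, ls, rfl⟩)
    rw [List.length_map] at hlen
    have hl : ∀ i (hi : i < ls.length), ls[i]? = some ls[i] :=
      fun i hi => List.getElem?_eq_getElem hi
    have hex : ∀ i : Fin ls.length, ∃ δ, ts[i.1]'(hlen.symm ▸ i.2) = ls[i.1].subst δ := fun i => by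
      refine ih _ (List.getElem_mem i.2) (fun x p q hp hq => ?_) (fun p u hu => ?_)
        (h.subterm (p := [i.1]) (.app ?_ (.refl _)) (.app ?_ (.refl _)))
      · simpa using hlin x (i :: p) (i :: q) (.app (hl i i.2) hp) (.app (hl i i.2) hq)
      · exact hvf (i :: p) u (.app (hl i i.2) hu)
      · rw [List.getElem?_map, hl i i.2]; rfl
      · exact List.getElem?_eq_getElem (hlen.symm ▸ i.2)
    choose δ hδ using hex
    have huniq : ∀ (i j : Fin ls.length) (x : V), x ∈ ls[i.1].vars → x ∈ ls[j.1].vars → i = j := by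
      intro i j x hi hj
      obtain ⟨p, hp⟩ := Term.exists_subtermAt_var hi
      obtain ⟨q, hq⟩ := Term.exists_subtermAt_var hj
      have := hlin x (i :: p) (j :: q) (.app (hl i i.2) hp) (.app (hl j j.2) hq)
      exact Fin.ext (List.cons.inj this).1
    refine ⟨fun x => if hx : ∃ i : Fin ls.length, x ∈ ls[i.1].vars then δ hx.choose x else .var x,
      ?_⟩
    rw [Term.subst_app]
    congr 1
    refine List.ext_getElem (by simpa using hlen) fun i hi hi' => ?_
    rw [List.getElem_map]
    rw [List.length_map] at hi'
    refine (hδ ⟨i, hi'⟩).trans (Term.subst_eq_subst_iff.2 fun x hx => ?_)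
    have hx' : ∃ i : Fin ls.length, x ∈ ls[i.1].vars := ⟨⟨i, hi'⟩, hx⟩
    rw [dif_pos hx', huniq hx'.choose ⟨i, hi'⟩ x hx'.choose_spec hx]

theorem subst_match_eq {s t l : Term F V} {p : Pos} {γ δ σ τ : V → Term F V}
    (hγ : SubtermAt s p (l.subst γ)) (hδ : SubtermAt t p (l.subst δ))
    (heq : s.subst σ = t.subst τ) : ∀ x ∈ l.vars, (γ x).subst σ = (δ x).subst τ := by
  rw [← Term.subst_eq_subst_iff, ← Term.subst_subst, ← Term.subst_subst]
  refine (hγ.subst σ).unique ?_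
  rw [heq]
  exact hδ.subst τ

theorem eq_var_of_notMem_substDom {l : Term F V} {γ : V → Term F V} (hdom : substDom γ = l.vars)
    {x : V} (hx : x ∉ l.vars) : γ x = .var x := by
  rw [← hdom] at hx
  exact not_not.1 hx

theorem vars_match_subset {s l : Term F V} {p : Pos} {γ : V → Term F V}
    (h : SubtermAt s p (l.subst γ)) {x : V} (hx : x ∈ l.vars) : (γ x).vars ⊆ s.vars :=
  fun _ hy => h.vars_subset (Term.mem_vars_subst.2 ⟨x, hx, hy⟩)

theorem mem_lvars_of_value_or_lvar {M : Model F V D} {X : Set V} {t : Term F V}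
    (h : M.IsValueTerm t ∨ ∃ y ∈ X, t = .var y) {y : V} (hy : y ∈ t.vars) : y ∈ X := by
  rcases h with h | ⟨z, hz, rfl⟩
  · exact (h.notMem_vars y hy).elim
  · rw [Term.mem_vars_var] at hy
    exact hy ▸ hz

theorem Rule.constr_vars_subset (ρ : Rule F V) : ρ.constr.vars ⊆ ρ.vars :=
  fun _ hx => .inr hx

theorem Rule.exVars_subset (ρ : Rule F V) : ρ.exVars ⊆ ρ.vars :=
  fun _ hx => .inl (.inr hx.1)

theorem Rule.lhs_vars_subset (ρ : Rule F V) : ρ.lhs.vars ⊆ ρ.vars :=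
  fun _ hx => .inl (.inl hx)

theorem RedexAt.transfer {M : Model F V D} {ρ : Rule F V} {T S : ECTerm F V} {p : Pos}
    {γ : V → Term F V} (hρ : ρ.WF) (hlvf : ρ.LeftValueFree M) (hS : S.WF)
    (hdT : Disjoint ρ.vars (T.term.vars ∪ T.ec.constr.vars))
    (hdS : Disjoint ρ.vars (S.term.vars ∪ S.ec.constr.vars))
    (hγ : RedexAt M ρ T p γ) (hsim : Similar M T.lvars S.lvars T.term S.term)
    (hsub : SubsumedBy M S T) : ∃ δ, RedexAt M ρ S p δ := by
  have hρS : ∀ x ∈ ρ.vars, x ∉ S.term.vars := fun x hx h => hdS.ne_of_mem hx (.inl h) rfl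
  have hρT : ∀ x ∈ ρ.vars, x ∉ T.term.vars := fun x hx h => hdT.ne_of_mem hx (.inl h) rfl
  obtain ⟨v, hv⟩ := hsim.exists_subtermAt hγ.matchAt
  obtain ⟨δ₀, rfl⟩ := (hsim.subterm hγ.matchAt hv).exists_match hlvf.1 hlvf.2
  obtain ⟨δ, hδ_in, hδ_out⟩ : ∃ δ : V → Term F V,
      (∀ x ∈ ρ.lhs.vars, δ x = δ₀ x) ∧ ∀ x ∉ ρ.lhs.vars, δ x = .var x :=
    ⟨fun x => if x ∈ ρ.lhs.vars then δ₀ x else .var x,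
      fun x hx => if_pos hx, fun x hx => if_neg hx⟩
  rw [← Term.subst_eq_subst_iff.2 hδ_in] at hv
  have hlv : ∀ x ∈ ρ.lhs.vars ∩ ρ.Z, M.IsValueTerm (δ x) ∨ ∃ y ∈ S.lvars, δ x = .var y := by
    intro x hx
    refine Similar.value_or_lvar (s := γ x) (X := T.lvars) ?_ (hγ.lvar x hx)
    obtain ⟨⟨σ, τ, h₁, h₂, h₃, heq⟩, σ', τ', h₁', h₂', h₃', heq'⟩ := hsim
    exact ⟨⟨σ, τ, h₁, h₂, h₃, subst_match_eq hγ.matchAt hv heq x hx.1⟩,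
      ⟨σ', τ', h₁', h₂', h₃', subst_match_eq hv hγ.matchAt heq' x hx.1⟩⟩
  refine ⟨δ, ?_, hv, hlv, fun ξ hξ => ?_⟩
  · ext x
    constructor
    · intro hx
      by_contra hxl
      exact hx (hδ_out x hxl)
    · intro hx hvar
      refine hρS x (ρ.lhs_vars_subset hx) (vars_match_subset hv hx ?_)
      rw [hvar, Term.mem_vars_var]
  · obtain ⟨η, hη, hηψ⟩ := EC.holdsUnder_iff.1 hξ
    obtain ⟨τ, hτ⟩ : ∃ τ : V → Term F V, ∀ y ∈ S.lvars, τ y = M.valTerm (ξ y) :=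
      ⟨fun y => M.valTerm (ξ y), fun y _ => rfl⟩
    obtain ⟨σ, hσ, hσφ, heq⟩ := hsub τ
      (fun y hy => by rw [hτ y hy]; exact M.isValueTerm_valTerm _)
      (substRespectsEC_iff.2
        ⟨fun y hy => by rw [hτ y (hS.2.1 hy)]; exact M.isValueTerm_valTerm _,
        η, fun y hy => by rw [hτ y (hS.2.1 hy), M.den_valTerm, hη y hy], hηψ⟩)
    obtain ⟨-, η₁, hη₁, hη₁φ⟩ := substRespectsEC_iff.1 hσφ
    obtain ⟨η₂, hη₂, hη₂π⟩ := EC.holdsUnder_iff.1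
      (hγ.implied (fun x => M.den (σ x)) (EC.holdsUnder_iff.2 ⟨η₁, hη₁, hη₁φ⟩))
    rw [M.holds_subst] at hη₂π
    refine EC.holdsUnder_iff.2
      ⟨fun x => if x ∈ ρ.constr.vars \ ρ.lhs.vars then η₂ x else ξ x, fun x hx => if_neg hx.2, ?_⟩
    rw [M.holds_subst]
    refine (M.holds_congr fun x hx => ?_).2 hη₂π
    by_cases hxl : x ∈ ρ.lhs.vars
    · have hxZ : x ∈ ρ.Z := hρ.1 (.inr hx)
      have h₁ : M.eval η₂ (γ x) = M.den ((γ x).subst σ) := by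
        refine M.eval_eq_den_subst fun y hy => hη₂ y ⟨Term.mem_vars_subst.2 ⟨x, hx, hy⟩, ?_⟩
        exact fun hy' => hρT y (ρ.constr_vars_subset hy'.1) (vars_match_subset hγ.matchAt hxl hy)
      rw [h₁, ← subst_match_eq hv hγ.matchAt heq x hxl]
      refine M.eval_eq_den_subst fun y hy => ?_
      have hyS := mem_lvars_of_value_or_lvar (hlv x ⟨hxl, hxZ⟩) hy
      rw [hτ y hyS, M.den_valTerm]
      exact if_neg fun hy' => hρS y (ρ.constr_vars_subset hy'.1) (hS.2.2.1 hyS)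
    · rw [hδ_out x hxl, eq_var_of_notMem_substDom hγ.dom hxl, M.eval_var, M.eval_var]
      exact if_pos ⟨hx, hxl⟩

theorem MGStepData.exists_of_redexAt {M : Model F V D} {ρ : Rule F V} {S : ECTerm F V} {p : Pos}
    {δ : V → Term F V} (h : RedexAt M ρ S p δ) : ∃ S', MGStepData M ρ S S' p δ := by
  obtain ⟨t, ht⟩ := h.matchAt.exists_replaceAt (ρ.rhs.subst δ)
  exact ⟨⟨ρ.exVars ∪ (S.lvars ∩ t.vars), t,
    ⟨(M.conj S.ec.constr (ρ.constr.subst δ)).vars \ t.vars,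
      M.conj S.ec.constr (ρ.constr.subst δ)⟩⟩, h, ht, rfl, rfl, rfl⟩

theorem MGStepData.fvars_eq {M : Model F V D} {ρ : Rule F V} {S S' : ECTerm F V} {p : Pos}
    {δ : V → Term F V} (h : MGStepData M ρ S S' p δ) :
    S'.ec.fvars = S'.ec.constr.vars ∩ S'.term.vars := by
  rw [EC.fvars, h.bnd, sdiff_sdiff_right_self]
  rfl

theorem MGStepData.exVars_subset_vars {M : Model F V D} {ρ : Rule F V} {S S' : ECTerm F V}
    {p : Pos} {δ : V → Term F V} (h : MGStepData M ρ S S' p δ) :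
    ρ.exVars ⊆ S'.term.vars := by
  intro x hx
  refine h.target.vars_inserted_subset (Term.mem_vars_subst.2 ⟨x, hx.1, ?_⟩)
  rw [eq_var_of_notMem_substDom h.redex.dom hx.2, Term.mem_vars_var]

theorem MGStepData.vars_subset {M : Model F V D} {ρ : Rule F V} {S S' : ECTerm F V}
    {p : Pos} {δ : V → Term F V} (h : MGStepData M ρ S S' p δ) :
    S'.term.vars ⊆ S.term.vars ∪ ρ.exVars := by
  intro x hx
  rcases h.target.vars_subset hx with hx | hx
  · exact .inl hx
  · obtain ⟨w, hw, hx⟩ := Term.mem_vars_subst.1 hx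
    by_cases hwl : w ∈ ρ.lhs.vars
    · exact .inl (vars_match_subset h.redex.matchAt hwl hx)
    · rw [eq_var_of_notMem_substDom h.redex.dom hwl, Term.mem_vars_var] at hx
      exact .inr ⟨hx ▸ hw, hx ▸ hwl⟩

theorem MGStepData.fvars_subset_lvars {M : Model F V D} {ρ : Rule F V} {S S' : ECTerm F V}
    {p : Pos} {δ : V → Term F V} (h : MGStepData M ρ S S' p δ) (hρ : ρ.WF) (hS : S.WF)
    (hdS : Disjoint ρ.vars (S.term.vars ∪ S.ec.constr.vars)) :
    S'.ec.fvars ⊆ S'.lvars := by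
  intro y hy
  rw [h.fvars_eq] at hy
  obtain ⟨hyc, hyt⟩ := hy
  rw [h.lv]
  rcases h.vars_subset hyt with hys | hys
  · refine .inr ⟨?_, hyt⟩
    rw [h.cstr, M.mem_vars_conj] at hyc
    rcases hyc with hyc | hyc
    · exact hS.2.1 ⟨hyc, fun hb => hS.2.2.2 y hb hys⟩
    · obtain ⟨x, hx, hyx⟩ := Term.mem_vars_subst.1 hyc
      by_cases hxl : x ∈ ρ.lhs.vars
      · exact mem_lvars_of_value_or_lvar (h.redex.lvar x ⟨hxl, hρ.1 (.inr hx)⟩) hyx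
      · rw [eq_var_of_notMem_substDom h.redex.dom hxl, Term.mem_vars_var] at hyx
        exact (hdS.ne_of_mem (ρ.constr_vars_subset hx) (.inl hys) hyx.symm).elim
  · exact .inl hys

theorem SubsumedBy.of_steps {M : Model F V D} {ρ : Rule F V} {T S T' S' : ECTerm F V} {p : Pos}
    {γ δ : V → Term F V} (hρ : ρ.WF) (hT : T.WF) (hS : S.WF)
    (hdT : Disjoint ρ.vars (T.term.vars ∪ T.ec.constr.vars))
    (hdS : Disjoint ρ.vars (S.term.vars ∪ S.ec.constr.vars))
    (hγ : MGStepData M ρ T T' p γ) (hδ : MGStepData M ρ S S' p δ)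
    (hsub : SubsumedBy M T S) : SubsumedBy M T' S' := by
  intro σ hσ hσr
  have hρS : ∀ x ∈ ρ.vars, x ∉ S.term.vars := fun x hx h => hdS.ne_of_mem hx (.inl h) rfl
  have hρS' : ∀ x ∈ ρ.vars, x ∉ S.ec.constr.vars := fun x hx h => hdS.ne_of_mem hx (.inr h) rfl
  have hρT : ∀ x ∈ ρ.vars, x ∉ T.term.vars := fun x hx h => hdT.ne_of_mem hx (.inl h) rfl
  obtain ⟨-, η, hη, hηφ⟩ := substRespectsEC_iff.1 hσr
  have hηc := hηφ
  rw [hγ.cstr, M.holds_conj, M.holds_subst] at hηc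
  rw [hγ.fvars_eq] at hη
  obtain ⟨σ', hσ'_in, hσ'_out⟩ : ∃ σ' : V → Term F V,
      (∀ x ∈ T.lvars \ T'.term.vars, σ' x = M.valTerm (η x)) ∧
      ∀ x ∉ T.lvars \ T'.term.vars, σ' x = σ x :=
    ⟨fun x => if x ∈ T.lvars \ T'.term.vars then M.valTerm (η x) else σ x,
      fun x hx => if_pos hx, fun x hx => if_neg hx⟩
  have hσ'_val : ∀ x ∈ T.lvars, M.IsValueTerm (σ' x) := fun x hx => by
    by_cases hx' : x ∈ T'.term.vars
    · rw [hσ'_out x fun h => h.2 hx']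
      exact hσ x (by rw [hγ.lv]; exact .inr ⟨hx, hx'⟩)
    · rw [hσ'_in x ⟨hx, hx'⟩]
      exact M.isValueTerm_valTerm _
  have hη_den : ∀ x ∈ T.lvars, x ∈ T'.ec.constr.vars → η x = M.den (σ' x) := fun x hx hxc => by
    by_cases hx' : x ∈ T'.term.vars
    · rw [hσ'_out x fun h => h.2 hx', hη x ⟨hxc, hx'⟩]
    · rw [hσ'_in x ⟨hx, hx'⟩, M.den_valTerm]
  obtain ⟨τ', hτ'_val, hτ'r, heq⟩ := hsub σ' hσ'_val (substRespectsEC_iff.2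
    ⟨fun x hx => hσ'_val x (hT.2.1 hx), η, fun x hx => hη_den x (hT.2.1 hx)
      (by rw [hγ.cstr, M.mem_vars_conj]; exact .inl hx.1), hηc.1⟩)
  obtain ⟨-, η', hη', hη'ψ⟩ := substRespectsEC_iff.1 hτ'r
  have hmatch := subst_match_eq hγ.redex.matchAt hδ.redex.matchAt heq
  obtain ⟨τ, hτ_in, hτ_out⟩ : ∃ τ : V → Term F V,
      (∀ x ∈ ρ.exVars, τ x = σ x) ∧ ∀ x ∉ ρ.exVars, τ x = τ' x :=
    ⟨fun x => if x ∈ ρ.exVars then σ x else τ' x, fun x hx => if_pos hx, fun x hx => if_neg hx⟩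
  have hτ_term : ∀ x ∈ S.term.vars, τ x = τ' x :=
    fun x hx => hτ_out x fun h => hρS x (ρ.exVars_subset h) hx
  have hτ_val : ∀ y ∈ S'.lvars, M.IsValueTerm (τ y) := fun y hy => by
    rw [hδ.lv] at hy
    rcases hy with hy | hy
    · rw [hτ_in y hy]
      exact hσ y (by rw [hγ.lv]; exact .inl hy)
    · rw [hτ_term y (hS.2.2.1 hy.1)]
      exact hτ'_val y hy.1
  refine ⟨τ, hτ_val, substRespectsEC_iff.2
    ⟨fun y hy => hτ_val y (hδ.fvars_subset_lvars hρ hS hdS hy), ?_⟩, ?_⟩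
  · obtain ⟨ζ, hζ_rule, hζ_bnd, hζ_den⟩ : ∃ ζ : V → D, (∀ x ∈ ρ.vars, ζ x = η x) ∧
        (∀ x ∉ ρ.vars, x ∈ S.ec.bvars → ζ x = η' x) ∧
        (∀ x ∉ ρ.vars, x ∉ S.ec.bvars → ζ x = M.den (τ' x)) :=
      ⟨fun x => if x ∈ ρ.vars then η x else if x ∈ S.ec.bvars then η' x else M.den (τ' x),
        fun x hx => if_pos hx, fun x hx hb => (if_neg hx).trans (if_pos hb),
        fun x hx hb => (if_neg hx).trans (if_neg hb)⟩
    have hζ_term : ∀ y ∈ S.term.vars, ζ y = M.den (τ' y) := fun y hy =>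
      hζ_den y (fun h => hρS y h hy) (fun hb => hS.2.2.2 y hb hy)
    refine ⟨ζ, fun y hy => ?_, ?_⟩
    · rw [hδ.fvars_eq] at hy
      obtain ⟨hyc, hyt⟩ := hy
      rcases hδ.vars_subset hyt with hys | hye
      · rw [hζ_term y hys, hτ_term y hys]
      · rw [hζ_rule y (ρ.exVars_subset hye), hτ_in y hye]
        refine hη y ⟨?_, hγ.exVars_subset_vars hye⟩
        rw [hγ.cstr, M.mem_vars_conj]
        rw [hδ.cstr, M.mem_vars_conj] at hyc
        rcases hyc with hyc | hyc
        · exact (hρS' y (ρ.exVars_subset hye) hyc).elim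
        · obtain ⟨x, hx, hyx⟩ := Term.mem_vars_subst.1 hyc
          by_cases hxl : x ∈ ρ.lhs.vars
          · exact (hρS y (ρ.exVars_subset hye)
              (vars_match_subset hδ.redex.matchAt hxl hyx)).elim
          · refine .inr (Term.mem_vars_subst.2 ⟨x, hx, ?_⟩)
            rwa [eq_var_of_notMem_substDom hγ.redex.dom hxl,
              ← eq_var_of_notMem_substDom hδ.redex.dom hxl]
    · rw [hδ.cstr, M.holds_conj, M.holds_subst]
      constructor
      · refine (M.holds_congr fun x hx => ?_).2 hη'ψ
        have hxρ : x ∉ ρ.vars := fun h => hρS' x h hx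
        by_cases hb : x ∈ S.ec.bvars
        · exact hζ_bnd x hxρ hb
        · rw [hζ_den x hxρ hb, hη' x ⟨hx, hb⟩]
      · refine (M.holds_congr fun x hx => ?_).2 hηc.2
        by_cases hxl : x ∈ ρ.lhs.vars
        · have h₁ : M.eval η (γ x) = M.den ((γ x).subst σ') := by
            refine M.eval_eq_den_subst fun y hy => hη_den y
              (mem_lvars_of_value_or_lvar (hγ.redex.lvar x ⟨hxl, hρ.1 (.inr hx)⟩) hy) ?_
            rw [hγ.cstr, M.mem_vars_conj]
            exact .inr (Term.mem_vars_subst.2 ⟨x, hx, hy⟩)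
          rw [h₁, hmatch x hxl]
          exact M.eval_eq_den_subst fun y hy =>
            hζ_term y (vars_match_subset hδ.redex.matchAt hxl hy)
        · rw [eq_var_of_notMem_substDom hγ.redex.dom hxl,
            eq_var_of_notMem_substDom hδ.redex.dom hxl, M.eval_var, M.eval_var]
          exact hζ_rule x (ρ.constr_vars_subset hx)
  · have hT'σ : T'.term.subst σ = T'.term.subst σ' :=
      Term.subst_eq_subst_iff.2 fun x hx => (hσ'_out x fun h => h.2 hx).symm
    have hrhs : (ρ.rhs.subst γ).subst σ' = (ρ.rhs.subst δ).subst τ := by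
      rw [Term.subst_subst, Term.subst_subst, Term.subst_eq_subst_iff]
      intro x hx
      by_cases hxl : x ∈ ρ.lhs.vars
      · rw [hmatch x hxl]
        exact Term.subst_eq_subst_iff.2 fun y hy =>
          (hτ_term y (vars_match_subset hδ.redex.matchAt hxl hy)).symm
      · rw [eq_var_of_notMem_substDom hγ.redex.dom hxl,
          eq_var_of_notMem_substDom hδ.redex.dom hxl, Term.subst_var, Term.subst_var,
          hτ_in x ⟨hx, hxl⟩]
        exact hσ'_out x fun h =>
          hρT x (ρ.exVars_subset ⟨hx, hxl⟩) (hT.2.2.1 h.1)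
    have h₁ := hγ.target.subst σ'
    rw [heq, ← Term.subst_eq_subst_iff.2 hτ_term, hrhs] at h₁
    rw [hT'σ]
    exact h₁.unique (hδ.target.subst τ)

/-- **Commutation of Rewrite Steps and Equivalence by Left-Value-Free Rules.** -/
theorem commutation_left_value_free {F V D : Type} (M : Model F V D)
    (ρ : Rule F V) (T S T' : ECTerm F V)
    (hρ : ρ.WF) (hlvf : ρ.LeftValueFree M)
    (hT : T.WF) (hS : S.WF)
    (hTsat : T.satisfiable M) (hSsat : S.satisfiable M)
    (hdT : Disjoint ρ.vars (T.term.vars ∪ T.ec.constr.vars))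
    (hdS : Disjoint ρ.vars (S.term.vars ∪ S.ec.constr.vars))
    (hstep : MGStep M ρ T T') (hequiv : ECEquiv M T S) :
    ∃ S' : ECTerm F V, ECEquiv M T' S' ∧ MGStep M ρ S S' := by
  obtain ⟨p, γ, hγ⟩ := hstep
  obtain ⟨δ, hδ⟩ := hγ.redex.transfer hρ hlvf hS hdT hdS
    ⟨hequiv.1.instanceOf hT hTsat, hequiv.2.instanceOf hS hSsat⟩ hequiv.2
  obtain ⟨S', hS'⟩ := MGStepData.exists_of_redexAt hδ
  exact ⟨S', ⟨hequiv.1.of_steps hρ hT hS hdT hdS hγ hS',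
    hequiv.2.of_steps hρ hS hT hdS hdT hS' hγ⟩, p, δ, hS'⟩

end

end LCTRS
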